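/- arXiv:math/0405298 — 2 statements merged into one kernel-verified Lean document; each statement's English description precedes it below -/
import Mathlib

section
/- Given nondecreasing arrival times 0 = U_0 ≤ U_1 ≤ U_2 ≤ … with U_1 > 0 and U_i → ∞, strictly positive service times v_1, v_2, …, and finitely many strictly positive initial service times ṽ_1, …, ṽ_{Z(0)} (Z(0) a nonnegative integer), set E(t) = sup{i ≥ 0 : U_i ≤ t}. Then there exists exactly one pair (μ, S), where μ is a finite-measure-valued path and S : [0,∞) → [0,∞), such that for all t ≥ 0: S(t) = ∫_0^t φ(μ(s)(ℝ₊)) ds and μ(t) = Σ_{j=1}^{Z(0)} δ⁺_{(ṽ_j − S(t))⁺} + Σ_{i=1}^{E(t)} δ⁺_{(v_i − S(t) + S(U_i))⁺}. -/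
open MeasureTheory Filter Set
noncomputable section
namespace PSQ

/-- ⟨g, ζ⟩ = ∫ g dζ -/
def pair (g : ℝ → ℝ) (ζ : Measure ℝ) : ℝ := ∫ x, g x ∂ζ

/-- total mass ⟨1, ζ⟩ of a finite measure, as a real number -/
def mass (ζ : Measure ℝ) : ℝ := (ζ Set.univ).toReal

/-- truncated Dirac measure δ⁺ₓ -/
def dplus (x : ℝ) : Measure ℝ := if 0 < x then Measure.dirac x else 0

/-- positive part x⁺ -/
def pos (x : ℝ) : ℝ := max x 0

/-- the arrival counting process E(t) = sup{i : U i ≤ t} -/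
def Ecount (U : ℕ → ℝ) (t : ℝ) : ℕ := sSup {i : ℕ | U i ≤ t}

/-- the standing hypotheses on the data of a pathwise processor sharing queue:
nondecreasing arrival times with `U 0 = 0`, `U 1 > 0`, `U i → ∞`, and strictly positive
service times and initial service times. -/
def QueueHyps (U v : ℕ → ℝ) (Z0 : ℕ) (vt : ℕ → ℝ) : Prop :=
  U 0 = 0 ∧ Monotone U ∧ 0 < U 1 ∧ Tendsto U atTop atTop ∧
    (∀ i, 1 ≤ i → 0 < v i) ∧ (∀ j, 1 ≤ j → 0 < vt j)

/-- the defining equations of the state descriptor μ and the cumulative service per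
job S:  `S t = ∫_0^t φ(⟨1, μ(s)⟩) ds` (recall `(0:ℝ)⁻¹ = 0` in Lean, matching φ(0)=0)
and `μ(t) = Σ_j δ⁺_{(ṽ_j - S(t))⁺} + Σ_{i ≤ E(t)} δ⁺_{(v_i - S(t) + S(U_i))⁺}`. -/
def StateEqns (U v : ℕ → ℝ) (Z0 : ℕ) (vt : ℕ → ℝ)
    (μ : ℝ → Measure ℝ) (S : ℝ → ℝ) : Prop :=
  ∀ t, 0 ≤ t →
    (S t = ∫ s in (0:ℝ)..t, (mass (μ s))⁻¹) ∧
    μ t = (∑ j ∈ Finset.range Z0, dplus (pos (vt (j+1) - S t)))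
        + ∑ i ∈ Finset.range (Ecount U t), dplus (pos (v (i+1) - S t + S (U (i+1))))

/-- fluid scaled state descriptor μ̄^r(t) = r⁻¹ μ(rt) -/
def fmu (μ : ℝ → Measure ℝ) (r t : ℝ) : Measure ℝ := ENNReal.ofReal (1/r) • μ (r*t)

/-- fluid scaled arrival process Ē^r(t) = r⁻¹ E(rt) -/
def fE (U : ℕ → ℝ) (r t : ℝ) : ℝ := (Ecount U (r*t) : ℝ) / r

/-- fluid scaled cumulative service S̄^r_{t,t'} = S(r t') - S(r t) -/
def fS (S : ℝ → ℝ) (r t t' : ℝ) : ℝ := S (r*t') - S (r*t)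

end PSQ
end

noncomputable section
open scoped Topology
namespace PSQ

/-- the number of jobs with positive residual service time at time `t`, when the cumulative
service per job is `S` -/
def jobCount (U v : ℕ → ℝ) (Z0 : ℕ) (vt : ℕ → ℝ) (S : ℝ → ℝ) (t : ℝ) : ℕ :=
  (∑ j ∈ Finset.range Z0, if S t < vt (j+1) then 1 else 0) +
    ∑ i ∈ Finset.range (Ecount U t), if S t < v (i+1) + S (U (i+1)) then 1 else 0

/-- the service rate per job -/
def rate (U v : ℕ → ℝ) (Z0 : ℕ) (vt : ℕ → ℝ) (S : ℝ → ℝ) (t : ℝ) : ℝ :=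
  (jobCount U v Z0 vt S t : ℝ)⁻¹

/-- `S` solves the integral equation for the cumulative service per job on `[0, T]` -/
def SolvesUpTo (U v : ℕ → ℝ) (Z0 : ℕ) (vt : ℕ → ℝ) (T : ℝ) (S : ℝ → ℝ) : Prop :=
  ∀ t, 0 ≤ t → t ≤ T → S t = ∫ s in (0:ℝ)..t, rate U v Z0 vt S s

/-- the state descriptor determined by the cumulative service per job -/
def descriptor (U v : ℕ → ℝ) (Z0 : ℕ) (vt : ℕ → ℝ) (S : ℝ → ℝ) (t : ℝ) : Measure ℝ :=
  (∑ j ∈ Finset.range Z0, dplus (pos (vt (j+1) - S t)))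
    + ∑ i ∈ Finset.range (Ecount U t), dplus (pos (v (i+1) - S t + S (U (i+1))))

variable {U v : ℕ → ℝ} {Z0 : ℕ} {vt : ℕ → ℝ} {S S' : ℝ → ℝ} {t T : ℝ}

lemma lt_Ecount_iff (hU0 : U 0 = 0) (hm : Monotone U) (hU : Tendsto U atTop atTop)
    (ht : 0 ≤ t) (i : ℕ) : i < Ecount U t ↔ U (i+1) ≤ t := by
  have hb : BddAbove {i : ℕ | U i ≤ t} := by
    obtain ⟨n, hn⟩ := (hU.eventually_gt_atTop t).exists
    refine ⟨n, fun k hk => ?_⟩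
    by_contra! h
    exact absurd (hm h.le) (not_le.2 (lt_of_le_of_lt hk hn))
  have hne : {i : ℕ | U i ≤ t}.Nonempty := ⟨0, by simpa [hU0] using ht⟩
  constructor
  · intro h
    have h1 : U (Ecount U t) ≤ t := Nat.sSup_mem hne hb
    exact (hm h).trans h1
  · intro h
    exact le_csSup hb h

lemma dplus_pos_univ (x : ℝ) : dplus (pos x) univ = if 0 < x then 1 else 0 := by
  unfold dplus pos
  by_cases h : 0 < x <;> simp [h]

lemma mass_descriptor (t : ℝ) :
    mass (descriptor U v Z0 vt S t) = jobCount U v Z0 vt S t := by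
  have e (a b c : ℝ) : 0 < a - b + c ↔ b < a + c := by constructor <;> intro h <;> linarith
  simp only [mass, descriptor, jobCount, Measure.add_apply, Measure.finsetSum_apply,
    dplus_pos_univ, sub_pos, e]
  rw [← ENNReal.toReal_natCast]
  push_cast
  rfl

lemma rate_nonneg (t : ℝ) : 0 ≤ rate U v Z0 vt S t := by
  unfold rate; positivity

lemma rate_le_one (t : ℝ) : rate U v Z0 vt S t ≤ 1 := Nat.cast_inv_le_one _

lemma rate_congr (hU0 : U 0 = 0) (hm : Monotone U) (hU : Tendsto U atTop atTop)
    (ht : 0 ≤ t) (h : ∀ s, 0 ≤ s → s ≤ t → S s = S' s) :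
    rate U v Z0 vt S t = rate U v Z0 vt S' t := by
  unfold rate jobCount
  rw [h t ht le_rfl]
  congr 3
  refine Finset.sum_congr rfl fun i hi => ?_
  rw [h (U (i+1)) (hU0 ▸ hm (Nat.zero_le _))
    ((lt_Ecount_iff hU0 hm hU ht i).1 (Finset.mem_range.1 hi))]

lemma integral_rate_congr (hU0 : U 0 = 0) (hm : Monotone U) (hU : Tendsto U atTop atTop)
    (ht : 0 ≤ t) (h : ∀ s, 0 ≤ s → s < t → S s = S' s) :
    ∫ s in (0:ℝ)..t, rate U v Z0 vt S s = ∫ s in (0:ℝ)..t, rate U v Z0 vt S' s := by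
  rw [intervalIntegral.integral_of_le ht, intervalIntegral.integral_of_le ht,
    integral_Ioc_eq_integral_Ioo, integral_Ioc_eq_integral_Ioo]
  refine setIntegral_congr_fun measurableSet_Ioo fun s hs => ?_
  exact rate_congr hU0 hm hU hs.1.le fun r hr hrs => h r hr (hrs.trans_lt hs.2)

lemma aemeasurable_rate (hU0 : U 0 = 0) (hm : Monotone U) (hU : Tendsto U atTop atTop)
    (hS : AEMeasurable S (volume.restrict (Icc 0 T))) :
    AEMeasurable (rate U v Z0 vt S) (volume.restrict (Icc 0 T)) := by
  have key : AEMeasurable (fun s => ((∑ j ∈ Finset.range Z0, if S s < vt (j+1) then (1:ℝ) else 0) +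
      ∑ i ∈ Finset.range (Ecount U T), if U (i+1) ≤ s then
        (if S s < v (i+1) + S (U (i+1)) then (1:ℝ) else 0) else 0)⁻¹)
      (volume.restrict (Icc 0 T)) := by
    have h1 (c : ℝ) : Measurable fun x : ℝ => if x < c then (1:ℝ) else 0 :=
      Measurable.ite measurableSet_Iio measurable_const measurable_const
    have h2 (c d : ℝ) : Measurable fun p : ℝ × ℝ => if c ≤ p.1 then
        (if p.2 < d then (1:ℝ) else 0) else 0 :=
      Measurable.ite (measurable_fst measurableSet_Ici) ((h1 d).comp measurable_snd)
        measurable_const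
    refine AEMeasurable.inv (AEMeasurable.add ?_ ?_)
    · exact Finset.aemeasurable_fun_sum _ fun j _ => (h1 _).comp_aemeasurable hS
    · exact Finset.aemeasurable_fun_sum _ fun i _ =>
        (h2 _ _).comp_aemeasurable (aemeasurable_id.prodMk hS)
  refine key.congr ?_
  filter_upwards [ae_restrict_mem measurableSet_Icc] with s hs
  unfold rate jobCount
  push_cast
  congr 2
  rw [← Finset.sum_filter]
  refine Finset.sum_congr ?_ fun _ _ => rfl
  ext i
  have hT := lt_Ecount_iff hU0 hm hU (hs.1.trans hs.2) i
  have hs' := lt_Ecount_iff hU0 hm hU hs.1 i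
  simp only [Finset.mem_filter, Finset.mem_range, hT, hs']
  exact ⟨fun h => h.2, fun h => ⟨h.trans hs.2, h⟩⟩

lemma SolvesUpTo.intervalIntegrable (hU0 : U 0 = 0) (hm : Monotone U)
    (hU : Tendsto U atTop atTop) (h : SolvesUpTo U v Z0 vt T S) {a b : ℝ}
    (ha : a ∈ Icc 0 T) (hb : b ∈ Icc 0 T) :
    IntervalIntegrable (rate U v Z0 vt S) volume a b := by
  set I : Set ℝ := {t | t ∈ Icc 0 T ∧ IntervalIntegrable (rate U v Z0 vt S) volume 0 t} with hI
  have hIconn : I.OrdConnected := by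
    refine ⟨fun x hx y hy z hz => ⟨⟨hx.1.1.trans hz.1, hz.2.trans hy.1.2⟩, ?_⟩⟩
    refine hy.2.mono_set ?_
    rw [uIcc_of_le (hx.1.1.trans hz.1), uIcc_of_le hy.1.1]
    exact Icc_subset_Icc le_rfl hz.2
  have hImeas : MeasurableSet I := hIconn.measurableSet
  have hmono : MonotoneOn S I := by
    intro x hx y hy hxy
    rw [h x hx.1.1 hx.1.2, h y hy.1.1 hy.1.2]
    exact intervalIntegral.integral_mono_interval le_rfl hx.1.1 hxy
      (Eventually.of_forall fun s => rate_nonneg s) hy.2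
  have hS : AEMeasurable S (volume.restrict (Icc 0 T)) := by
    have hunion : Icc 0 T = I ∪ (Icc 0 T \ I) :=
      (union_sdiff_cancel fun x hx => hx.1).symm
    rw [hunion, aemeasurable_union_iff]
    refine ⟨aemeasurable_restrict_of_monotoneOn hImeas hmono, ?_⟩
    refine (aemeasurable_const (b := (0:ℝ))).congr ?_
    filter_upwards [ae_restrict_mem (measurableSet_Icc.diff hImeas)] with s hs
    rw [h s hs.1.1 hs.1.2]
    exact (intervalIntegral.integral_undef fun hc => hs.2 ⟨hs.1, hc⟩).symm
  have hint : IntegrableOn (rate U v Z0 vt S) (Icc 0 T) := by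
    refine Integrable.of_bound (aemeasurable_rate hU0 hm hU hS).aestronglyMeasurable 1 ?_
    refine Eventually.of_forall fun s => ?_
    rw [Real.norm_of_nonneg (rate_nonneg s)]
    exact rate_le_one s
  exact (hint.mono_set (uIcc_subset_Icc ha hb)).intervalIntegrable

lemma SolvesUpTo.sub_eq (hU0 : U 0 = 0) (hm : Monotone U)
    (hU : Tendsto U atTop atTop) (h : SolvesUpTo U v Z0 vt T S) {a b : ℝ}
    (ha : 0 ≤ a) (hab : a ≤ b) (hb : b ≤ T) :
    S b - S a = ∫ s in a..b, rate U v Z0 vt S s := by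
  rw [h a ha (hab.trans hb), h b (ha.trans hab) hb]
  have h0 : (0:ℝ) ∈ Icc 0 T := ⟨le_rfl, ha.trans (hab.trans hb)⟩
  exact intervalIntegral.integral_interval_sub_left
    (h.intervalIntegrable hU0 hm hU h0 ⟨ha.trans hab, hb⟩)
    (h.intervalIntegrable hU0 hm hU h0 ⟨ha, hab.trans hb⟩)

lemma SolvesUpTo.mem_Icc (hU0 : U 0 = 0) (hm : Monotone U)
    (hU : Tendsto U atTop atTop) (h : SolvesUpTo U v Z0 vt T S) {a b : ℝ}
    (ha : 0 ≤ a) (hab : a ≤ b) (hb : b ≤ T) :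
    S b ∈ Icc (S a) (S a + (b - a)) := by
  have hsub := h.sub_eq hU0 hm hU ha hab hb
  have h1 : 0 ≤ ∫ s in a..b, rate U v Z0 vt S s :=
    intervalIntegral.integral_nonneg hab fun s _ => rate_nonneg s
  have h2 : ∫ s in a..b, rate U v Z0 vt S s ≤ ∫ s in a..b, (1:ℝ) :=
    intervalIntegral.integral_mono_on hab
      (h.intervalIntegrable hU0 hm hU ⟨ha, hab.trans hb⟩ ⟨ha.trans hab, hb⟩)
      intervalIntegrable_const fun s _ => rate_le_one s
  rw [intervalIntegral.integral_const, smul_eq_mul, mul_one] at h2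
  constructor <;> linarith

/-- The service rate is locally constant to the right of any time, uniformly over all
continuations that are nondecreasing and 1-Lipschitz from that time on. -/
lemma exists_rate_eq (hU0 : U 0 = 0) (hm : Monotone U) (hU : Tendsto U atTop atTop)
    (ht : 0 ≤ t) (S : ℝ → ℝ) :
    ∃ ε > 0, ∀ S' : ℝ → ℝ, (∀ s, 0 ≤ s → s ≤ t → S' s = S s) → ∀ r, t ≤ r → r ≤ t + ε →
      S' r ∈ Icc (S t) (S t + (r - t)) → rate U v Z0 vt S' r = rate U v Z0 vt S t := by
  have hnear (x c : ℝ) : ∀ᶠ ε in 𝓝[>] (0:ℝ), x < c → x + ε < c := by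
    by_cases hx : x < c
    · have : ∀ᶠ ε in 𝓝[>] (0:ℝ), ε < c - x :=
        nhdsWithin_le_nhds (Iio_mem_nhds (sub_pos.2 hx))
      filter_upwards [this] with ε hε _
      linarith
    · exact Eventually.of_forall fun ε h => absurd h hx
  have h1 : ∀ᶠ ε in 𝓝[>] (0:ℝ), ∀ j ∈ Finset.range Z0, S t < vt (j+1) → S t + ε < vt (j+1) :=
    (Finset.eventually_all _).2 fun j _ => hnear _ _
  have h2 : ∀ᶠ ε in 𝓝[>] (0:ℝ), ∀ i ∈ Finset.range (Ecount U t),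
      S t < v (i+1) + S (U (i+1)) → S t + ε < v (i+1) + S (U (i+1)) :=
    (Finset.eventually_all _).2 fun i _ => hnear _ _
  obtain ⟨ε, ⟨⟨h1, h2⟩, h3⟩, hε⟩ :=
    (((h1.and h2).and (hnear t (U (Ecount U t + 1)))).and self_mem_nhdsWithin).exists
  refine ⟨ε, hε, fun S' hS' r htr hr hmem => ?_⟩
  have hE : Ecount U r = Ecount U t := by
    apply le_antisymm
    · by_contra! hlt
      have hr' := (lt_Ecount_iff hU0 hm hU (ht.trans htr) _).1 hlt
      have hnt : ¬ U (Ecount U t + 1) ≤ t := fun hc =>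
        lt_irrefl _ ((lt_Ecount_iff hU0 hm hU ht _).2 hc)
      linarith [h3 (not_le.1 hnt)]
    · by_contra! hlt
      have hr' := (lt_Ecount_iff hU0 hm hU ht _).1 hlt
      exact lt_irrefl _ ((lt_Ecount_iff hU0 hm hU (ht.trans htr) _).2 (hr'.trans htr))
  have hiff {c : ℝ} (hc : S t < c → S t + ε < c) : S' r < c ↔ S t < c :=
    ⟨fun h => hmem.1.trans_lt h, fun h => by linarith [hc h, hmem.2]⟩
  unfold rate jobCount
  rw [hE]
  congr 3
  · refine Finset.sum_congr rfl fun j hj => ?_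
    simp only [hiff (h1 j hj)]
  · refine Finset.sum_congr rfl fun i hi => ?_
    rw [hS' (U (i+1)) (hU0 ▸ hm (Nat.zero_le _))
      ((lt_Ecount_iff hU0 hm hU ht i).1 (Finset.mem_range.1 hi))]
    simp only [hiff (h2 i hi)]

lemma real_induction_nonneg {P : ℝ → Prop}
    (hlim : ∀ t, 0 ≤ t → (∀ s, 0 ≤ s → s < t → P s) → P t)
    (hstep : ∀ t, 0 ≤ t → (∀ s, 0 ≤ s → s ≤ t → P s) →
      ∃ ε > 0, ∀ s, t < s → s ≤ t + ε → P s) :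
    ∀ t, 0 ≤ t → P t := by
  by_contra! hcon
  obtain ⟨b, hb0, hb⟩ := hcon
  set B : Set ℝ := {t | 0 ≤ t ∧ ¬ P t}
  have hne : B.Nonempty := ⟨b, hb0, hb⟩
  have hbdd : BddBelow B := ⟨0, fun x hx => hx.1⟩
  have h0 : 0 ≤ sInf B := le_csInf hne fun x hx => hx.1
  have hlt : ∀ s, 0 ≤ s → s < sInf B → P s := fun s hs hsB => by
    by_contra hP
    exact absurd (csInf_le hbdd ⟨hs, hP⟩) (not_le.2 hsB)
  have hle : ∀ s, 0 ≤ s → s ≤ sInf B → P s := fun s hs hsB => by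
    rcases hsB.lt_or_eq with h | h
    · exact hlt s hs h
    · exact h ▸ hlim _ h0 hlt
  obtain ⟨ε, hε, hstep⟩ := hstep _ h0 hle
  have : sInf B + ε ≤ sInf B := by
    refine le_csInf hne fun x hx => ?_
    by_contra! hlt'
    rcases le_or_gt x (sInf B) with h | h
    · exact hx.2 (hle x hx.1 h)
    · exact hx.2 (hstep x h hlt'.le)
  linarith

lemma SolvesUpTo.mono (h : SolvesUpTo U v Z0 vt T S) (htT : t ≤ T) :
    SolvesUpTo U v Z0 vt t S := fun s hs hst => h s hs (hst.trans htT)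

lemma SolvesUpTo.eq (hU0 : U 0 = 0) (hm : Monotone U) (hU : Tendsto U atTop atTop)
    (h : SolvesUpTo U v Z0 vt T S) (h' : SolvesUpTo U v Z0 vt T S') :
    ∀ t, 0 ≤ t → t ≤ T → S t = S' t := by
  refine real_induction_nonneg (P := fun t => t ≤ T → S t = S' t) ?_ ?_
  · intro t ht hlt htT
    rw [h t ht htT, h' t ht htT]
    exact integral_rate_congr hU0 hm hU ht fun s hs hst => hlt s hs hst (hst.le.trans htT)
  · intro t ht hle
    obtain ⟨ε, hε, hr⟩ := exists_rate_eq (v := v) (Z0 := Z0) (vt := vt) hU0 hm hU ht S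
    refine ⟨ε, hε, fun s hts hs hsT => ?_⟩
    have htT : t ≤ T := hts.le.trans hsT
    have heq : ∀ r, 0 ≤ r → r ≤ t → S' r = S r := fun r hr hrt =>
      (hle r hr hrt (hrt.trans htT)).symm
    have e1 := h.sub_eq hU0 hm hU ht hts.le hsT
    have e2 := h'.sub_eq hU0 hm hU ht hts.le hsT
    have hint : ∫ r in t..s, rate U v Z0 vt S r = ∫ r in t..s, rate U v Z0 vt S' r := by
      refine intervalIntegral.integral_congr fun r hrs => ?_
      rw [uIcc_of_le hts.le] at hrs
      have m1 := h.mem_Icc hU0 hm hU ht hrs.1 (hrs.2.trans hsT)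
      have m2 := h'.mem_Icc hU0 hm hU ht hrs.1 (hrs.2.trans hsT)
      rw [heq t ht le_rfl] at m2
      rw [hr S (fun _ _ _ => rfl) r hrs.1 (hrs.2.trans hs) m1,
        hr S' heq r hrs.1 (hrs.2.trans hs) m2]
    linarith [heq t ht le_rfl]

lemma SolvesUpTo.congr (hU0 : U 0 = 0) (hm : Monotone U) (hU : Tendsto U atTop atTop)
    (h : SolvesUpTo U v Z0 vt T S) (hSS' : ∀ s, 0 ≤ s → s ≤ T → S s = S' s) :
    SolvesUpTo U v Z0 vt T S' := by
  intro t ht htT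
  rw [← hSS' t ht htT, h t ht htT]
  exact integral_rate_congr hU0 hm hU ht fun s hs hst => hSS' s hs (hst.le.trans htT)

lemma SolvesUpTo.exists_extend (hU0 : U 0 = 0) (hm : Monotone U) (hU : Tendsto U atTop atTop)
    (hT : 0 ≤ T) (h : SolvesUpTo U v Z0 vt T S) :
    ∃ ε > 0, ∃ S', SolvesUpTo U v Z0 vt (T + ε) S' := by
  obtain ⟨ε, hε, hr⟩ := exists_rate_eq (v := v) (Z0 := Z0) (vt := vt) hU0 hm hU hT S
  set c := rate U v Z0 vt S T with hc
  set S' : ℝ → ℝ := fun t => if t ≤ T then S t else S T + (t - T) * c with hS'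
  have hle : ∀ s, s ≤ T → S' s = S s := fun s hs => if_pos hs
  have hge : ∀ s, T ≤ s → S' s = S T + (s - T) * c := fun s hs => by
    rcases hs.eq_or_lt with rfl | hs
    · simp [hS']
    · exact if_neg (not_le.2 hs)
  have hsol : SolvesUpTo U v Z0 vt T S' := h.congr hU0 hm hU fun s _ hs => (hle s hs).symm
  refine ⟨ε, hε, S', fun t ht htT => ?_⟩
  rcases le_or_gt t T with hlt | hlt
  · exact hsol t ht hlt
  have hrate : ∀ s ∈ uIcc T t, rate U v Z0 vt S' s = c := fun s hs => by
    rw [uIcc_of_le hlt.le] at hs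
    refine hr S' (fun s _ hs => hle s hs) s hs.1 (hs.2.trans htT) ?_
    rw [hge s hs.1]
    have hsT : 0 ≤ s - T := sub_nonneg.2 hs.1
    have := mul_nonneg hsT (rate_nonneg (U := U) (v := v) (Z0 := Z0) (vt := vt) (S := S) T)
    have := mul_le_of_le_one_right hsT
      (rate_le_one (U := U) (v := v) (Z0 := Z0) (vt := vt) (S := S) T)
    constructor <;> linarith
  have i2 : IntervalIntegrable (rate U v Z0 vt S') volume T t :=
    (intervalIntegrable_const (c := c)).congr fun s hs => (hrate s (uIoc_subset_uIcc hs)).symm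
  rw [← intervalIntegral.integral_add_adjacent_intervals
      (hsol.intervalIntegrable hU0 hm hU ⟨le_rfl, hT⟩ ⟨hT, le_rfl⟩) i2,
    ← hsol T hT le_rfl, intervalIntegral.integral_congr hrate, intervalIntegral.integral_const,
    hge t hlt.le, hle T le_rfl, smul_eq_mul]

lemma solvesUpTo_diagonal (hU0 : U 0 = 0) (hm : Monotone U) (hU : Tendsto U atTop atTop)
    {F : ℝ → ℝ → ℝ} (hF : ∀ s, 0 ≤ s → s ≤ T → SolvesUpTo U v Z0 vt s (F s)) :
    SolvesUpTo U v Z0 vt T fun s => F s s := by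
  intro t ht htT
  refine (hF t ht htT t ht le_rfl).trans ?_
  refine integral_rate_congr hU0 hm hU ht fun s hs hst => ?_
  exact ((hF t ht htT).mono hst.le).eq hU0 hm hU (hF s hs (hst.le.trans htT)) s hs le_rfl

lemma exists_solvesUpTo (hU0 : U 0 = 0) (hm : Monotone U) (hU : Tendsto U atTop atTop)
    (v : ℕ → ℝ) (Z0 : ℕ) (vt : ℕ → ℝ) :
    ∀ T, 0 ≤ T → ∃ S, SolvesUpTo U v Z0 vt T S := by
  refine real_induction_nonneg ?_ ?_
  · intro T hT hlt
    choose! F hF using fun s (hs : 0 ≤ s ∧ s < T) => hlt s hs.1 hs.2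
    set S : ℝ → ℝ := fun t => if t < T then F t t else
      ∫ s in (0:ℝ)..T, rate U v Z0 vt (fun r => F r r) s
    have hS : ∀ s, s < T → F s s = S s := fun s hs => (if_pos hs).symm
    refine ⟨S, fun t ht htT => ?_⟩
    rcases htT.lt_or_eq with h | rfl
    · have hd := solvesUpTo_diagonal (T := t) hU0 hm hU
        fun s hs hst => hF s ⟨hs, hst.trans_lt h⟩
      exact hd.congr hU0 hm hU (fun s _ hst => hS s (hst.trans_lt h)) t ht le_rfl
    · rw [show S t = ∫ s in (0:ℝ)..t, rate U v Z0 vt (fun r => F r r) s from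
        if_neg (lt_irrefl t)]
      exact integral_rate_congr hU0 hm hU ht fun s _ hst => hS s hst
  · intro T hT hle
    obtain ⟨S, hS⟩ := hle T hT le_rfl
    obtain ⟨ε, hε, S', hS'⟩ := hS.exists_extend hU0 hm hU hT
    exact ⟨ε, hε, fun s _ hs => ⟨S', hS'.mono hs⟩⟩

lemma stateEqns_iff {μ : ℝ → Measure ℝ} :
    StateEqns U v Z0 vt μ S ↔
      (∀ T, SolvesUpTo U v Z0 vt T S) ∧ ∀ t, 0 ≤ t → μ t = descriptor U v Z0 vt S t := by
  have key (hμ : ∀ t, 0 ≤ t → μ t = descriptor U v Z0 vt S t) (t : ℝ) (ht : 0 ≤ t) :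
      ∫ s in (0:ℝ)..t, (mass (μ s))⁻¹ = ∫ s in (0:ℝ)..t, rate U v Z0 vt S s := by
    refine intervalIntegral.integral_congr fun s hs => ?_
    rw [uIcc_of_le ht] at hs
    simp only [hμ s hs.1, mass_descriptor, rate]
  constructor
  · intro h
    have hμ : ∀ t, 0 ≤ t → μ t = descriptor U v Z0 vt S t := fun t ht => (h t ht).2
    exact ⟨fun T t ht _ => (h t ht).1.trans (key hμ t ht), hμ⟩
  · rintro ⟨hS, hμ⟩ t ht
    exact ⟨(hS t t ht le_rfl).trans (key hμ t ht).symm, hμ t ht⟩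

lemma descriptor_congr (hU0 : U 0 = 0) (hm : Monotone U) (hU : Tendsto U atTop atTop)
    (ht : 0 ≤ t) (h : ∀ s, 0 ≤ s → s ≤ t → S s = S' s) :
    descriptor U v Z0 vt S t = descriptor U v Z0 vt S' t := by
  unfold descriptor
  rw [h t ht le_rfl]
  congr 1
  refine Finset.sum_congr rfl fun i hi => ?_
  rw [h (U (i+1)) (hU0 ▸ hm (Nat.zero_le _))
    ((lt_Ecount_iff hU0 hm hU ht i).1 (Finset.mem_range.1 hi))]

end PSQ

end

open PSQ in
/-- existence and uniqueness (on `[0,∞)`) of the pair `(μ, S)` solving the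
processor sharing state equations. -/
theorem stmt_1 (U v : ℕ → ℝ) (Z0 : ℕ) (vt : ℕ → ℝ) (hq : QueueHyps U v Z0 vt) :
    ∃ μS : (ℝ → MeasureTheory.Measure ℝ) × (ℝ → ℝ),
      StateEqns U v Z0 vt μS.1 μS.2 ∧
      ∀ μS' : (ℝ → MeasureTheory.Measure ℝ) × (ℝ → ℝ),
        StateEqns U v Z0 vt μS'.1 μS'.2 → ∀ t, 0 ≤ t → μS'.1 t = μS.1 t ∧ μS'.2 t = μS.2 t := by
  obtain ⟨hU0, hm, -, hU, -, -⟩ := hq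
  choose! F hF using exists_solvesUpTo hU0 hm hU v Z0 vt
  have hS (T : ℝ) : SolvesUpTo U v Z0 vt T fun s => F s s :=
    solvesUpTo_diagonal hU0 hm hU fun s hs _ => hF s hs
  refine ⟨(descriptor U v Z0 vt fun s => F s s, fun s => F s s),
    stateEqns_iff.2 ⟨hS, fun _ _ => rfl⟩, fun μS' h t ht => ?_⟩
  obtain ⟨hS', hμ'⟩ := stateEqns_iff.1 h
  have heq := (hS' t).eq hU0 hm hU (hS t)
  exact ⟨(hμ' t ht).trans (descriptor_congr hU0 hm hU ht heq), heq t ht le_rfl⟩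
end

section
/- Let α > 0, let ν be a Borel probability measure on ℝ₊, let T, L > 1 and r > 0, and let ε, l, p, κ, γ, M, N be as in the good-path properties. Suppose a processor-sharing path satisfies the level-(ε, l, κ, γ, M) properties (for r, T, L). Fix an integer 0 ≤ m ≤ ⌊rT⌋ and t ∈ [m, m+L], and define τ_ε = sup{ s ∈ [0,t] : ⟨1, μ̄^r(s)⟩ < ε/8 } (with τ_ε = −∞ if this set is empty) and τ = max{0, τ_ε, t − 8M²/ε}. Then μ̄^r(τ)({ x ∈ ℝ₊ : S̄^r_{τ,t} < x ≤ S̄^r_{τ,t} + κ }) ≤ ε/4. -/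
open MeasureTheory Filter Set
namespace PSQ

/-- The constraints tying together the constants of the good-path properties:
`ε ∈ (0,1)`, `l, p, κ, γ > 0`, `M > 1`, `l < ε/(32α)`, `κ < l/(2M)`,
`γ < (κε/4) ∧ (l/4)`. -/
def GoodConsts (α ε l p κ γ M : ℝ) : Prop :=
  ε ∈ Set.Ioo (0:ℝ) 1 ∧ 0 < l ∧ 0 < p ∧ 0 < κ ∧ 0 < γ ∧ 1 < M ∧
    l < ε/(32*α) ∧ κ < l/(2*M) ∧ γ < min (κ*ε/4) (l/4)

/-- A processor sharing path satisfies the level-(ε, l, κ, γ, M) good-path properties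
(for r, T, L), with `N = ⌈64M²/(κε²)⌉ + 1`. -/
def GoodPath (U v : ℕ → ℝ) (μ : ℝ → Measure ℝ) (ν : Measure ℝ)
    (T L r ε l p κ γ M : ℝ) : Prop :=
  ∀ m : ℕ, m ≤ ⌊r * T⌋₊ →
    (∀ t ∈ Set.Icc (0:ℝ) L, fE U r ((m:ℝ) + t + l) - fE U r ((m:ℝ) + t) ≤ ε/16) ∧
    (∀ t ∈ Set.Icc (0:ℝ) L,
      max (max (mass (fmu μ r ((m:ℝ)+t))) (pair id (fmu μ r ((m:ℝ)+t))))
        (pair (fun x => x ^ ((1:ℝ)+p)) (fmu μ r ((m:ℝ)+t))) ≤ M) ∧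
    (∀ x : ℝ, 0 ≤ x → ((fmu μ r 0) (Set.Icc x (x+κ))).toReal ≤ ε/4) ∧
    (∀ t ∈ Set.Icc (0:ℝ) L,
      |pair id (fmu μ r ((m:ℝ)+t)) - pair id (fmu μ r (m:ℝ))| ≤ γ/4) ∧
    (∀ t ∈ Set.Icc (0:ℝ) L, ∀ k : ℕ, k ≤ ⌈64*M^2/(κ*ε^2)⌉₊ + 1 →
      (1/r) * (∑ i ∈ Finset.Ioc (Ecount U (r*((m:ℝ)+t))) (Ecount U (r*((m:ℝ)+t+l))),
          if (k:ℝ)*κ ≤ v i ∧ v i < ((k:ℝ)+1)*κ then (1:ℝ) else 0)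
        ≤ (ε/8) * (ν (Set.Ico (((k:ℝ)-1/2)*κ) (((k:ℝ)+3/2)*κ))).toReal)

end PSQ

namespace PSQ

section Dirac

instance isFiniteMeasure_dplus (x : ℝ) : IsFiniteMeasure (dplus x) := by
  unfold dplus
  split_ifs <;> infer_instance

lemma mass_add (ζ η : Measure ℝ) [IsFiniteMeasure ζ] [IsFiniteMeasure η] :
    mass (ζ + η) = mass ζ + mass η := by
  simp [mass, ENNReal.toReal_add]

lemma mass_sum {ι : Type*} (s : Finset ι) (ζ : ι → Measure ℝ) [∀ i, IsFiniteMeasure (ζ i)] :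
    mass (∑ i ∈ s, ζ i) = ∑ i ∈ s, mass (ζ i) := by
  simp [mass, Measure.coe_finsetSum, ENNReal.toReal_sum]

lemma mass_dplus_pos (x : ℝ) : mass (dplus (pos x)) = if 0 < x then 1 else 0 := by
  by_cases h : 0 < x <;> simp [mass, dplus, pos, h]

lemma integrable_id_dplus (x : ℝ) : Integrable id (dplus x) := by
  unfold dplus
  split_ifs
  · exact integrable_dirac (by simp)
  · exact integrable_zero_measure

lemma dplus_Iio_zero (x : ℝ) : dplus x (Set.Iio 0) = 0 := by
  unfold dplus
  split_ifs with h
  · simp [h.le]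
  · simp

end Dirac

section Counting

variable {U : ℕ → ℝ}

lemma bddAbove_arrivals (hU : Tendsto U atTop atTop) (t : ℝ) :
    BddAbove {i : ℕ | U i ≤ t} := by
  obtain ⟨n, hn⟩ := eventually_atTop.1 (hU.eventually_gt_atTop t)
  refine ⟨n, fun i hi => ?_⟩
  by_contra! h
  exact absurd (hn i h.le) (not_lt.2 hi)

lemma monotone_Ecount (hU : Tendsto U atTop atTop) : Monotone (Ecount U) := by
  intro a b hab
  rcases Set.eq_empty_or_nonempty {i : ℕ | U i ≤ a} with h | h
  · simp [Ecount, h]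
  · exact csSup_le_csSup (bddAbove_arrivals hU b) h fun i (hi : U i ≤ a) => hi.trans hab

end Counting

section Path

variable {U v : ℕ → ℝ} {Z0 : ℕ} {vt : ℕ → ℝ} {μ : ℝ → Measure ℝ} {S : ℝ → ℝ}

lemma StateEqns.isFiniteMeasure (h : StateEqns U v Z0 vt μ S) {t : ℝ} (ht : 0 ≤ t) :
    IsFiniteMeasure (μ t) := by
  rw [(h t ht).2]
  infer_instance

lemma StateEqns.integrable_id (h : StateEqns U v Z0 vt μ S) {t : ℝ} (ht : 0 ≤ t) :
    Integrable id (μ t) := by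
  rw [(h t ht).2]
  exact Integrable.add_measure
    (integrable_finsetSum_measure.2 fun _ _ => integrable_id_dplus _)
    (integrable_finsetSum_measure.2 fun _ _ => integrable_id_dplus _)

lemma StateEqns.Iio_zero (h : StateEqns U v Z0 vt μ S) {t : ℝ} (ht : 0 ≤ t) :
    μ t (Set.Iio 0) = 0 := by
  rw [(h t ht).2]
  simp [Measure.coe_finsetSum, dplus_Iio_zero]

lemma StateEqns.mass_eq (h : StateEqns U v Z0 vt μ S) {t : ℝ} (ht : 0 ≤ t) :
    mass (μ t) = (∑ j ∈ Finset.range Z0, if 0 < vt (j + 1) - S t then (1 : ℝ) else 0)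
      + ∑ i ∈ Finset.range (Ecount U t),
          if 0 < v (i + 1) - S t + S (U (i + 1)) then (1 : ℝ) else 0 := by
  rw [(h t ht).2, mass_add, mass_sum, mass_sum]
  simp only [mass_dplus_pos]

lemma StateEqns.inv_mass_le_one (h : StateEqns U v Z0 vt μ S) {t : ℝ} (ht : 0 ≤ t) :
    (mass (μ t))⁻¹ ≤ 1 := by
  rw [h.mass_eq ht, Finset.sum_boole, Finset.sum_boole, ← Nat.cast_add]
  exact Nat.cast_inv_le_one _

lemma inv_mass_nonneg (ζ : Measure ℝ) : 0 ≤ (mass ζ)⁻¹ :=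
  inv_nonneg.2 ENNReal.toReal_nonneg

lemma StateEqns.service_nonneg (h : StateEqns U v Z0 vt μ S) {t : ℝ} (ht : 0 ≤ t) :
    0 ≤ S t := by
  rw [(h t ht).1]
  exact intervalIntegral.integral_nonneg ht fun _ _ => inv_mass_nonneg _

lemma StateEqns.intervalIntegrable_of_aestronglyMeasurable (h : StateEqns U v Z0 vt μ S)
    {t : ℝ} (ht : 0 ≤ t)
    (hm : AEStronglyMeasurable (fun s => (mass (μ s))⁻¹) (volume.restrict (Set.Ioc 0 t))) :
    IntervalIntegrable (fun s => (mass (μ s))⁻¹) volume 0 t := by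
  rw [intervalIntegrable_iff_integrableOn_Ioc_of_le ht]
  refine Integrable.of_bound hm 1 ?_
  filter_upwards [ae_restrict_mem measurableSet_Ioc] with s hs
  rw [Real.norm_of_nonneg (inv_mass_nonneg _)]
  exact h.inv_mass_le_one hs.1.le

/-- Where the service rate fails to be integrable on `[0, t]`, the Bochner integral defining `S t`
vanishes, so no job has left and the number of jobs is `Z0 + E t`. -/
lemma StateEqns.mass_eq_of_not_intervalIntegrable (hq : QueueHyps U v Z0 vt)
    (h : StateEqns U v Z0 vt μ S) {t : ℝ} (ht : 0 ≤ t)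
    (hn : ¬ IntervalIntegrable (fun s => (mass (μ s))⁻¹) volume 0 t) :
    mass (μ t) = (Z0 : ℝ) + Ecount U t := by
  have hS : S t = 0 := by
    rw [(h t ht).1, intervalIntegral.integral_undef hn]
  obtain ⟨hU0, hUm, -, -, hv, hvt⟩ := hq
  have hinit (j : ℕ) : 0 < vt (j + 1) - S t := by
    rw [hS, sub_zero]
    exact hvt _ (Nat.le_add_left 1 j)
  have harr (i : ℕ) : 0 < v (i + 1) - S t + S (U (i + 1)) := by
    rw [hS, sub_zero]
    exact add_pos_of_pos_of_nonneg (hv _ (Nat.le_add_left 1 i))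
      (h.service_nonneg (hU0 ▸ hUm (Nat.zero_le _)))
  simp [h.mass_eq ht, hinit, harr]

lemma StateEqns.intervalIntegrable (hq : QueueHyps U v Z0 vt)
    (h : StateEqns U v Z0 vt μ S) {t : ℝ} (ht : 0 ≤ t) :
    IntervalIntegrable (fun s => (mass (μ s))⁻¹) volume 0 t := by
  by_contra hn
  set f : ℝ → ℝ := fun s => (mass (μ s))⁻¹ with hf
  set A : Set ℝ := {s | 0 ≤ s ∧ IntervalIntegrable f volume 0 s} with hA
  have hA0 : (0 : ℝ) ∈ A := ⟨le_rfl, by simp⟩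
  have hdown {a b : ℝ} (ha : 0 ≤ a) (hab : a ≤ b) (hb : b ∈ A) : a ∈ A :=
    ⟨ha, hb.2.mono_set (by
      rw [uIcc_of_le ha, uIcc_of_le (ha.trans hab)]
      exact Icc_subset_Icc_right hab)⟩
  have hAb : BddAbove A := ⟨t, fun s hs => le_of_not_gt fun hlt => hn (hdown ht hlt.le hs).2⟩
  set c := sSup A
  have hc : 0 ≤ c := le_csSup hAb hA0
  have hlow : AEStronglyMeasurable f (volume.restrict (Set.Ioo 0 c)) := by
    obtain ⟨u, hu, huc⟩ : ∃ u : ℕ → ℝ, (∀ n, u n < c) ∧ Tendsto u atTop (nhds c) := by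
      obtain ⟨u, -, h1, h2⟩ := exists_seq_strictMono_tendsto c
      exact ⟨u, h1, h2⟩
    have hcover : Set.Ioo 0 c ⊆ ⋃ n, Set.Ioc 0 (u n) := fun x hx => by
      obtain ⟨n, hn⟩ := (huc.eventually (lt_mem_nhds hx.2)).exists
      exact mem_iUnion.2 ⟨n, hx.1, hn.le⟩
    refine AEStronglyMeasurable.mono_set hcover ?_
    refine aestronglyMeasurable_iUnion_iff.2 fun n => ?_
    obtain ⟨a, ha, hna⟩ := exists_lt_of_lt_csSup ⟨0, hA0⟩ (hu n)
    exact (ha.2.1.mono_set (Ioc_subset_Ioc_right hna.le)).aestronglyMeasurable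
  have hhigh : AEStronglyMeasurable f (volume.restrict (Set.Ioi c)) := by
    have hE : Measurable fun s => ((Z0 : ℝ) + Ecount U s)⁻¹ := by
      have : Monotone fun s => (Ecount U s : ℝ) := fun a b hab =>
        Nat.cast_le.2 (monotone_Ecount hq.2.2.2.1 hab)
      exact (this.measurable.const_add _).inv
    refine hE.aestronglyMeasurable.congr ?_
    filter_upwards [ae_restrict_mem measurableSet_Ioi] with s hs
    have hs0 : 0 ≤ s := hc.trans (le_of_lt hs)
    have hsn : ¬ IntervalIntegrable f volume 0 s := fun hi =>
      absurd (le_csSup hAb ⟨hs0, hi⟩) (not_le.2 hs)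
    exact (congrArg Inv.inv (h.mass_eq_of_not_intervalIntegrable hq hs0 hsn)).symm
  refine hn (h.intervalIntegrable_of_aestronglyMeasurable ht ?_)
  have hunion : AEStronglyMeasurable f (volume.restrict (Set.Ioo 0 c ∪ ({c} ∪ Set.Ioi c))) :=
    aestronglyMeasurable_union_iff.2 ⟨hlow, aestronglyMeasurable_union_iff.2 ⟨by simp, hhigh⟩⟩
  refine hunion.mono_set fun x hx => ?_
  rcases lt_trichotomy x c with hxc | hxc | hxc
  · exact Or.inl ⟨hx.1, hxc⟩
  · exact Or.inr (Or.inl hxc)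
  · exact Or.inr (Or.inr hxc)

lemma StateEqns.intervalIntegrable_Icc (hq : QueueHyps U v Z0 vt)
    (h : StateEqns U v Z0 vt μ S) {a b : ℝ} (ha : 0 ≤ a) (hb : 0 ≤ b) :
    IntervalIntegrable (fun s => (mass (μ s))⁻¹) volume a b :=
  (h.intervalIntegrable hq ha).symm.trans (h.intervalIntegrable hq hb)

lemma StateEqns.service_sub (hq : QueueHyps U v Z0 vt)
    (h : StateEqns U v Z0 vt μ S) {a b : ℝ} (ha : 0 ≤ a) (hb : 0 ≤ b) :
    S b - S a = ∫ s in a..b, (mass (μ s))⁻¹ := by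
  rw [(h a ha).1, (h b hb).1]
  exact intervalIntegral.integral_interval_sub_left (h.intervalIntegrable hq hb)
    (h.intervalIntegrable hq ha)

lemma StateEqns.service_mono (hq : QueueHyps U v Z0 vt)
    (h : StateEqns U v Z0 vt μ S) {a b : ℝ} (ha : 0 ≤ a) (hab : a ≤ b) : S a ≤ S b := by
  rw [← sub_nonneg, h.service_sub hq ha (ha.trans hab)]
  exact intervalIntegral.integral_nonneg hab fun _ _ => inv_mass_nonneg _

/-- The number of jobs grows at most by the number of arrivals. -/
lemma StateEqns.mass_le_add_arrivals (hq : QueueHyps U v Z0 vt)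
    (h : StateEqns U v Z0 vt μ S) {a b : ℝ} (ha : 0 ≤ a) (hab : a ≤ b) :
    mass (μ b) ≤ mass (μ a) + ((Ecount U b : ℝ) - Ecount U a) := by
  have hS := h.service_mono hq ha hab
  have hE := monotone_Ecount hq.2.2.2.1 hab
  have hite {x y : ℝ} (hxy : x ≤ y) :
      (if 0 < x then (1 : ℝ) else 0) ≤ if 0 < y then (1 : ℝ) else 0 := by
    split_ifs <;> linarith
  rw [h.mass_eq ha, h.mass_eq (ha.trans hab), ← Finset.sum_range_add_sum_Ico _ hE]
  have hinit : (∑ j ∈ Finset.range Z0, if 0 < vt (j + 1) - S b then (1 : ℝ) else 0)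
      ≤ ∑ j ∈ Finset.range Z0, if 0 < vt (j + 1) - S a then (1 : ℝ) else 0 :=
    Finset.sum_le_sum fun j _ => hite (by linarith)
  have hold : (∑ i ∈ Finset.range (Ecount U a),
        if 0 < v (i + 1) - S b + S (U (i + 1)) then (1 : ℝ) else 0)
      ≤ ∑ i ∈ Finset.range (Ecount U a),
        if 0 < v (i + 1) - S a + S (U (i + 1)) then (1 : ℝ) else 0 :=
    Finset.sum_le_sum fun i _ => hite (by linarith)
  have hnew : (∑ i ∈ Finset.Ico (Ecount U a) (Ecount U b),
        if 0 < v (i + 1) - S b + S (U (i + 1)) then (1 : ℝ) else 0)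
      ≤ (Ecount U b : ℝ) - Ecount U a := by
    refine (Finset.sum_le_card_nsmul _ _ 1 fun i _ => by split_ifs <;> norm_num).trans ?_
    simp [Nat.cast_sub hE]
  linarith

/-- Markov's inequality for the state descriptor. -/
lemma StateEqns.mul_measure_Ici_le (h : StateEqns U v Z0 vt μ S) {t : ℝ} (ht : 0 ≤ t) (c : ℝ) :
    c * (μ t (Set.Ici c)).toReal ≤ pair id (μ t) := by
  have := h.isFiniteMeasure ht
  have hnonneg : 0 ≤ᵐ[μ t] (id : ℝ → ℝ) := by
    refine measure_mono_null (fun x hx => ?_) (h.Iio_zero ht)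
    simpa using hx
  exact mul_meas_ge_le_integral_of_nonneg hnonneg (h.integrable_id ht) c

end Path

section Fluid

variable {r : ℝ}

lemma toReal_fmu (hr : 0 < r) (μ : ℝ → Measure ℝ) (t : ℝ) (s : Set ℝ) :
    (fmu μ r t s).toReal = (μ (r * t) s).toReal / r := by
  have : (0 : ℝ) ≤ 1 / r := by positivity
  simp only [fmu, Measure.smul_apply, smul_eq_mul, ENNReal.toReal_mul, ENNReal.toReal_ofReal this]
  ring

lemma mass_fmu (hr : 0 < r) (μ : ℝ → Measure ℝ) (t : ℝ) :
    mass (fmu μ r t) = mass (μ (r * t)) / r :=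
  toReal_fmu hr μ t Set.univ

lemma pair_fmu (hr : 0 < r) (g : ℝ → ℝ) (μ : ℝ → Measure ℝ) (t : ℝ) :
    pair g (fmu μ r t) = pair g (μ (r * t)) / r := by
  have : (0 : ℝ) ≤ 1 / r := by positivity
  simp only [pair, fmu, integral_smul_measure, ENNReal.toReal_ofReal this, smul_eq_mul]
  ring

/-- Every time in `[0, m + L]` lies in one of the windows `[m', m' + L]` with `m' ≤ m`. -/
lemma exists_window {L : ℝ} (hL : 1 < L) {m : ℕ} {s : ℝ} (hs : 0 ≤ s) (hsm : s ≤ m + L) :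
    ∃ m' : ℕ, m' ≤ m ∧ s - m' ∈ Set.Icc (0 : ℝ) L := by
  rcases le_total m ⌊s⌋₊ with h | h
  · exact ⟨m, le_rfl, sub_nonneg.2 ((Nat.le_floor_iff hs).1 h), by linarith⟩
  · refine ⟨⌊s⌋₊, h, sub_nonneg.2 (Nat.floor_le hs), ?_⟩
    linarith [Nat.lt_floor_add_one s]

end Fluid

section GoodPath

variable {U v : ℕ → ℝ} {μ : ℝ → Measure ℝ} {ν : Measure ℝ} {T L r ε l p κ γ M : ℝ}

lemma GoodPath.arrivals_le (h : GoodPath U v μ ν T L r ε l p κ γ M) (hL : 1 < L) {m : ℕ}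
    (hm : m ≤ ⌊r * T⌋₊) {s : ℝ} (hs : 0 ≤ s) (hsm : s ≤ m + L) :
    fE U r (s + l) - fE U r s ≤ ε / 16 := by
  obtain ⟨m', hm', hw⟩ := exists_window hL hs hsm
  simpa using (h m' (hm'.trans hm)).1 _ hw

lemma GoodPath.mass_le_and_pair_le (h : GoodPath U v μ ν T L r ε l p κ γ M) (hL : 1 < L) {m : ℕ}
    (hm : m ≤ ⌊r * T⌋₊) {s : ℝ} (hs : 0 ≤ s) (hsm : s ≤ m + L) :
    mass (fmu μ r s) ≤ M ∧ pair id (fmu μ r s) ≤ M := by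
  obtain ⟨m', hm', hw⟩ := exists_window hL hs hsm
  have hb := (h m' (hm'.trans hm)).2.1 _ hw
  rw [add_sub_cancel] at hb
  exact max_le_iff.1 ((le_max_left _ _).trans hb)

variable {Z0 : ℕ} {vt : ℕ → ℝ} {S : ℝ → ℝ}

/-- The mass is still small at the last time before `t` at which it was below `ε / 8`. -/
lemma GoodPath.mass_sSup_le (hq : QueueHyps U v Z0 vt) (hstate : StateEqns U v Z0 vt μ S)
    (h : GoodPath U v μ ν T L r ε l p κ γ M) (hr : 0 < r) (hL : 1 < L) (hl : 0 < l)
    {m : ℕ} (hm : m ≤ ⌊r * T⌋₊) {t : ℝ} (ht : t ≤ m + L)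
    (hne : {s : ℝ | s ∈ Set.Icc 0 t ∧ mass (fmu μ r s) < ε / 8}.Nonempty) :
    mass (fmu μ r (sSup {s : ℝ | s ∈ Set.Icc 0 t ∧ mass (fmu μ r s) < ε / 8})) ≤
      ε / 8 + ε / 16 := by
  set B := {s : ℝ | s ∈ Set.Icc 0 t ∧ mass (fmu μ r s) < ε / 8}
  have hB : BddAbove B := ⟨t, fun s hs => hs.1.2⟩
  obtain ⟨s, hs, hsl⟩ := exists_lt_of_lt_csSup hne (sub_lt_self (sSup B) hl)
  have hsB : s ≤ sSup B := le_csSup hB hs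
  have harr := h.arrivals_le hL hm hs.1.1 (hs.1.2.trans ht)
  have hE : fE U r (sSup B) ≤ fE U r (s + l) := by
    have := monotone_Ecount hq.2.2.2.1
      (mul_le_mul_of_nonneg_left (show sSup B ≤ s + l by linarith) hr.le)
    unfold fE
    gcongr
  have hmass := div_le_div_of_nonneg_right (hstate.mass_le_add_arrivals hq
    (mul_nonneg hr.le hs.1.1) (mul_le_mul_of_nonneg_left hsB hr.le)) hr.le
  rw [add_div, sub_div, ← mass_fmu hr, ← mass_fmu hr] at hmass
  have := hs.2
  unfold fE at harr hE
  linarith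

/-- If the scaled mass is positive and at most `M`, each job is served at rate at least `1 / M`. -/
lemma StateEqns.le_fS (hq : QueueHyps U v Z0 vt) (hstate : StateEqns U v Z0 vt μ S) (hr : 0 < r)
    {a b : ℝ} (ha : 0 ≤ a) (hab : a ≤ b)
    (hmass : ∀ s ∈ Set.Ioo a b, 0 < mass (fmu μ r s) ∧ mass (fmu μ r s) ≤ M) :
    (b - a) / M ≤ fS S r a b := by
  have hrab : r * a ≤ r * b := mul_le_mul_of_nonneg_left hab hr.le
  have hra : 0 ≤ r * a := mul_nonneg hr.le ha
  have hle : ∀ u ∈ Set.Ioo (r * a) (r * b), (r * M)⁻¹ ≤ (mass (μ u))⁻¹ := by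
    intro u hu
    have hru : r * (u / r) = u := by field_simp
    have hu' : u / r ∈ Set.Ioo a b :=
      ⟨(lt_div_iff₀' hr).2 hu.1, (div_lt_iff₀' hr).2 hu.2⟩
    obtain ⟨h1, h2⟩ := hmass _ hu'
    rw [mass_fmu hr, hru] at h1 h2
    exact inv_anti₀ ((div_pos_iff_of_pos_right hr).1 h1) ((div_le_iff₀' hr).1 h2)
  have hint := intervalIntegral.integral_mono_on_of_le_Ioo hrab
    (intervalIntegrable_const (μ := volume))
    (hstate.intervalIntegrable_Icc hq hra (hra.trans hrab)) hle
  rw [← hstate.service_sub hq hra (hra.trans hrab), intervalIntegral.integral_const,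
    smul_eq_mul] at hint
  calc (b - a) / M = (r * b - r * a) * (r * M)⁻¹ := by field_simp
    _ ≤ fS S r a b := hint

end GoodPath

end PSQ

open PSQ MeasureTheory in
/-- Lemma 3.9. -/
theorem stmt_6 (α : ℝ) (hα : 0 < α) (ν : Measure ℝ) (hν : IsProbabilityMeasure ν)
    (hνsupp : ν (Set.Iio 0) = 0)
    (T L r : ℝ) (hT : 1 < T) (hL : 1 < L) (hr : 0 < r)
    (ε l p κ γ M : ℝ) (hconsts : GoodConsts α ε l p κ γ M)
    (U v : ℕ → ℝ) (Z0 : ℕ) (vt : ℕ → ℝ) (hq : QueueHyps U v Z0 vt)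
    (μ : ℝ → Measure ℝ) (S : ℝ → ℝ) (hstate : StateEqns U v Z0 vt μ S)
    (hgood : GoodPath U v μ ν T L r ε l p κ γ M)
    (m : ℕ) (hm : m ≤ ⌊r*T⌋₊) (t : ℝ) (ht : t ∈ Set.Icc (m:ℝ) ((m:ℝ)+L))
    (τε τ : ℝ)
    (hτε : τε = sSup {s : ℝ | s ∈ Set.Icc 0 t ∧ mass (fmu μ r s) < ε/8})
    (hτ : τ = max 0 (max τε (t - 8*M^2/ε))) :
    ((fmu μ r τ) (Set.Ioc (fS S r τ t) (fS S r τ t + κ))).toReal ≤ ε/4 := by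
  obtain ⟨⟨hε, -⟩, hl, -, hκ, -, hM, -⟩ := hconsts
  have ht0 : 0 ≤ t := (Nat.cast_nonneg m).trans ht.1
  have hM0 : 0 < M := one_pos.trans hM
  set B := {s : ℝ | s ∈ Set.Icc 0 t ∧ mass (fmu μ r s) < ε / 8} with hB
  have hBb : BddAbove B := ⟨t, fun s hs => hs.1.2⟩
  have hτ0 : 0 ≤ τ := hτ ▸ le_max_left _ _
  have hτετ : τε ≤ τ := hτ ▸ (le_max_left _ _).trans (le_max_right _ _)
  have hτεt : τε ≤ t := hτε ▸ Real.sSup_le (fun s hs => hs.1.2) ht0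
  have hτt : τ ≤ t := by
    rw [hτ]
    exact max_le ht0 (max_le hτεt (sub_le_self _ (by positivity)))
  have hfin (s : ℝ) (hs : 0 ≤ s) : IsFiniteMeasure (μ (r * s)) :=
    hstate.isFiniteMeasure (mul_nonneg hr.le hs)
  have := hfin τ hτ0
  rw [toReal_fmu hr]
  have hcases : τ = 0 ∨ (0 < τ ∧ τ = τε) ∨ τ = t - 8 * M ^ 2 / ε := by
    rcases hτ0.eq_or_lt with h0 | h0
    · exact Or.inl h0.symm
    · rcases max_choice 0 (max τε (t - 8 * M ^ 2 / ε)) with h | h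
      · exact Or.inl (hτ.trans h)
      · rcases max_choice τε (t - 8 * M ^ 2 / ε) with h' | h'
        · exact Or.inr (Or.inl ⟨h0, hτ.trans (h.trans h')⟩)
        · exact Or.inr (Or.inr (hτ.trans (h.trans h')))
  rcases hcases with h0 | ⟨hpos, hτeq⟩ | hτeq
  · have hS : 0 ≤ fS S r τ t :=
      sub_nonneg.2 (hstate.service_mono hq (mul_nonneg hr.le hτ0)
        (mul_le_mul_of_nonneg_left hτt hr.le))
    have hc := (hgood m hm).2.2.1 _ hS
    rw [toReal_fmu hr, ← h0] at hc
    refine le_trans ?_ hc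
    gcongr
    · exact measure_ne_top _ _
    · exact Set.Ioc_subset_Icc_self
  · have hne : B.Nonempty := by
      by_contra hne
      rw [Set.not_nonempty_iff_eq_empty] at hne
      rw [hne, Real.sSup_empty] at hτε
      linarith
    have hmass := hgood.mass_sSup_le hq hstate hr hL hl hm ht.2 hne
    rw [← hτε, ← hτeq, mass_fmu hr] at hmass
    calc (μ (r * τ) (Set.Ioc (fS S r τ t) (fS S r τ t + κ))).toReal / r
        ≤ mass (μ (r * τ)) / r := by
          unfold mass
          gcongr
          · exact measure_ne_top _ _
          · exact Set.subset_univ _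
      _ ≤ ε / 4 := by linarith
  · have hserv := hstate.le_fS (M := M) hq hr hτ0 hτt fun s hs => by
      have hs0 : 0 ≤ s := hτ0.trans hs.1.le
      have hsB : s ∉ B := fun h =>
        absurd (le_csSup hBb h) (not_le.2 ((hτε ▸ hτετ).trans_lt hs.1))
      refine ⟨?_, (hgood.mass_le_and_pair_le hL hm hs0 (hs.2.le.trans ht.2)).1⟩
      by_contra! hle
      exact hsB ⟨⟨hs0, hs.2.le⟩, by linarith⟩
    have hlen : (t - τ) / M = 8 * M / ε := by
      rw [hτeq]
      field_simp
      ring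
    rw [hlen] at hserv
    have hpair := (hgood.mass_le_and_pair_le hL hm hτ0 (hτt.trans ht.2)).2
    have hmarkov := hstate.mul_measure_Ici_le (mul_nonneg hr.le hτ0) (8 * M / ε)
    rw [pair_fmu hr] at hpair
    have hbound : 8 * M / ε * ((μ (r * τ) (Set.Ici (8 * M / ε))).toReal / r) ≤ M := by
      rw [← mul_div_assoc]
      exact (div_le_div_of_nonneg_right hmarkov hr.le).trans hpair
    calc (μ (r * τ) (Set.Ioc (fS S r τ t) (fS S r τ t + κ))).toReal / r
        ≤ (μ (r * τ) (Set.Ici (8 * M / ε))).toReal / r := by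
          gcongr
          · exact measure_ne_top _ _
          · exact fun x hx => hserv.trans hx.1.le
      _ ≤ M / (8 * M / ε) := (le_div_iff₀' (by positivity)).2 hbound
      _ = ε / 8 := by field_simp
      _ ≤ ε / 4 := by linarith
end
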